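/- (High-degree claim 2: no bad high-degree points.) In the affine setup of the high-degree lemma, conditioned on any choice of f_0 ∈ A_{≤d} and g_1,…,g_ℓ ∈ A_{≤γ} for which W_ℓ is finite, the probability over uniformly random h ∈ A_{≤η} that H_f ∩ W_ℓ ∩ U_{>d/(ℓ+1)} = ∅ is 1 − o(1) as d → ∞, where H_f is the hypersurface f = 0 and U_{>d/(ℓ+1)} denotes the set of closed points of U of degree > d/(ℓ+1). -/

import Mathlib

/-!
# Statement 12 (high-degree lemma, claim 2: no bad high-degree points)

Affine setup of the high-degree lemma, as in Statement 11: `F` is the field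
with `q = p^a` elements, `A = F[x_1, …, x_n]`, `U ⊆ 𝔸^n` the affine variety
of dimension `m` cut out by `I ⊆ A` (modelled by its geometric points in
`F̄^n`), with sections `t_1, …, t_ℓ ∈ A`, unit `s` on `U` and rescaled
dual-basis derivations `D_i = s ∂_i : A → A/I(U)`, `D_i t_j = δ_{ij} s`.
Put `τ = max_i deg t_i`, `γ = ⌊(d − τ)/p⌋`, `η = ⌊d/p⌋`, and for
`f₀ ∈ A_{≤d}`, `g ∈ (A_{≤γ})^ℓ`, `h ∈ A_{≤η}` let
`f = f₀ + ∑ j g_j^p t_j + h^p`; `W_ℓ = U ∩ {D_1 f = ⋯ = D_ℓ f = 0}` (this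
does not involve `h`).  The degree of the closed point underlying a geometric
point `v` is `deg v = [F(v_1, …, v_n) : F]`; `H_f` is the hypersurface
`f = 0`.

Conclusion: conditioned on any choice of `f₀, g_1, …, g_ℓ` for which `W_ℓ` is
finite, the probability over a uniformly random `h ∈ A_{≤η}` that
`H_f ∩ W_ℓ ∩ U_{> d/(ℓ+1)} = ∅` is `1 − o(1)` as `d → ∞` (uniformly in the
choices).
-/

open MvPolynomial Filter Topology Function

noncomputable section

/-- `A = F[x_1, …, x_n]`. -/
abbrev Apoly (F : Type) [Field F] (n : ℕ) : Type := MvPolynomial (Fin n) F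

/-- `A_{≤ d}`, the polynomials of total degree at most `d`. -/
abbrev Ale (F : Type) [Field F] (n d : ℕ) : Type :=
  ↥(restrictTotalDegree (Fin n) F d)

/-- Geometric points of `𝔸^n` over the algebraic closure of `F`. -/
abbrev Pbar (F : Type) [Field F] (n : ℕ) : Type := Fin n → AlgebraicClosure F

/-- The zero locus in `F̄^n` of an ideal `I ⊆ A`. -/
def zeroLocusA (F : Type) [Field F] (n : ℕ) (I : Ideal (Apoly F n)) :
    Set (Pbar F n) :=
  {v | ∀ g ∈ I, aeval v g = 0}

/-- The degree `[κ(x) : F]` of the closed point underlying a geometric point. -/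
def degPt (F : Type) [Field F] (n : ℕ) (v : Pbar F n) : ℕ :=
  Module.finrank F (Algebra.adjoin F (Set.range v))

/-- A residue class `c ∈ A/I` vanishes at a point `v`. -/
def vanishAt (F : Type) [Field F] (n : ℕ) (I : Ideal (Apoly F n))
    (v : Pbar F n) (c : Apoly F n ⧸ I) : Prop :=
  ∀ b : Apoly F n, Ideal.Quotient.mk I b = c → aeval v b = 0

/-- `W_k = U ∩ {D_1 f = ⋯ = D_k f = 0}` (0-indexed), for
`f = f₀ + ∑ j, g_j^p t_j (+ h^p)`. -/
def Wset (F : Type) [Field F] (n ℓ pp : ℕ) (I : Ideal (Apoly F n))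
    (D : Fin ℓ → Derivation F (Apoly F n) (Apoly F n ⧸ I))
    (t : Fin ℓ → Apoly F n) (f₀ : Apoly F n) (g : Fin ℓ → Apoly F n)
    (k : ℕ) : Set (Pbar F n) :=
  {v | v ∈ zeroLocusA F n I ∧ ∀ j : Fin ℓ, (j : ℕ) < k →
    vanishAt F n I v (D j (f₀ + ∑ r, g r ^ pp * t r))}

theorem le_height_ker_eval {R : Type*} [CommRing R] [IsDomain R] {n : ℕ} (v : Fin n → R) :
    (n : ℕ∞) ≤ (RingHom.ker (MvPolynomial.eval v : MvPolynomial (Fin n) R →+* R)).height := by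
  let φ : ℕ → MvPolynomial (Fin n) R →ₐ[R] MvPolynomial (Fin n) R := fun k =>
    aeval fun j : Fin n => if (j : ℕ) < k then C (v j) else X j
  have hprime : ∀ k, (RingHom.ker (φ k)).IsPrime := fun k => RingHom.ker_isPrime _
  have hcomp : ∀ k, (φ (k + 1)).comp (φ k) = φ (k + 1) := by
    intro k
    ext j : 1
    simp only [φ, AlgHom.comp_apply, aeval_X]
    by_cases hj : (j : ℕ) < k
    · simp [hj, Nat.lt_succ_of_lt hj]
    · simp [hj]
  have hstep : ∀ k < n, RingHom.ker (φ k) < RingHom.ker (φ (k + 1)) := by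
    intro k hk
    refine lt_of_le_of_ne (fun a ha => ?_) fun h => ?_
    · rw [RingHom.mem_ker] at ha ⊢
      rw [← hcomp k, AlgHom.comp_apply, ha, map_zero]
    · have h1 : X ⟨k, hk⟩ - C (v ⟨k, hk⟩) ∈ RingHom.ker (φ (k + 1)) := by
        simp [RingHom.mem_ker, φ]
      rw [← h, RingHom.mem_ker] at h1
      have h2 := congrArg (MvPolynomial.eval fun j : Fin n => v j + 1) h1
      simp [φ] at h2
  have hmain : ∀ k ≤ n, (k : ℕ∞) ≤ (RingHom.ker (φ k)).height := by
    intro k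
    induction k with
    | zero => simp
    | succ k ih =>
      intro hk
      have := hprime k
      have := hprime (k + 1)
      have h1 := Ideal.height_add_one_le_of_lt_of_isPrime (hstep k hk)
      push_cast
      exact (add_le_add_left (ih (by omega)) 1).trans h1
  refine (hmain n le_rfl).trans (Ideal.height_mono fun a ha => ?_)
  rw [RingHom.mem_ker] at ha ⊢
  have h := congrArg (MvPolynomial.eval v) ha
  have h2 : (MvPolynomial.eval v).comp (φ n : MvPolynomial (Fin n) R →+* MvPolynomial (Fin n) R) = MvPolynomial.eval v := by
    ext <;> simp [φ]
  rw [map_zero] at h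
  rw [← h2]
  exact h

theorem ker_eval_eq_of_le {K : Type*} [Field K] {n : ℕ} {v w : Fin n → K}
    (h : RingHom.ker (MvPolynomial.eval w) ≤ RingHom.ker (MvPolynomial.eval v)) : w = v := by
  ext i
  have h1 : X i - C (w i) ∈ RingHom.ker (MvPolynomial.eval w) := by simp [RingHom.mem_ker]
  have h2 := h h1
  simp only [RingHom.mem_ker, map_sub, eval_X, eval_C] at h2
  exact (sub_eq_zero.mp h2).symm

theorem eq_ker_eval_of_isPrime_of_finite {K : Type*} [Field K] [IsAlgClosed K] {n : ℕ}
    {S : Set (MvPolynomial (Fin n) K)} (hfin : {v : Fin n → K | ∀ P ∈ S, MvPolynomial.eval v P = 0}.Finite)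
    {𝔭 : Ideal (MvPolynomial (Fin n) K)} (h𝔭 : 𝔭.IsPrime) (hS : S ⊆ 𝔭) {v : Fin n → K}
    (hv : 𝔭 ≤ RingHom.ker (MvPolynomial.eval v)) : 𝔭 = RingHom.ker (MvPolynomial.eval v) := by
  have hZ : (zeroLocus K 𝔭).Finite :=
    hfin.subset fun w hw P hP => by simpa [aeval_eq_eval] using hw P (hS hP)
  have h1 : hZ.toFinset.inf (fun w => RingHom.ker (MvPolynomial.eval w)) ≤ 𝔭 := by
    intro a ha
    rw [← IsPrime.vanishingIdeal_zeroLocus (K := K) 𝔭]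
    intro w hw
    have h2 := Finset.inf_le (f := fun w : Fin n → K => RingHom.ker (MvPolynomial.eval w))
      (hZ.mem_toFinset.mpr hw) ha
    simpa [aeval_eq_eval] using h2
  obtain ⟨w, -, hw⟩ := (Ideal.IsPrime.inf_le' h𝔭).mp h1
  obtain rfl := ker_eval_eq_of_le (hw.trans hv)
  exact le_antisymm hv hw

theorem exists_forall_minimalPrimes_le_height {K A : Type*} [Field K] [Infinite K] [CommRing A]
    [IsNoetherianRing A] [Algebra K A] (M : Submodule K A) (k : ℕ) :
    ∃ Q : Fin k → A, (∀ i, Q i ∈ M) ∧ ∀ 𝔭 ∈ (Ideal.span (Set.range Q)).minimalPrimes,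
      (M : Set A) ⊆ 𝔭 ∨ (k : ℕ∞) ≤ 𝔭.height := by
  induction k with
  | zero => exact ⟨Fin.elim0, fun i => i.elim0, fun 𝔭 _ => Or.inr (by simp)⟩
  | succ k ih =>
    obtain ⟨Q, hQM, hQ⟩ := ih
    have hfin : {𝔭 ∈ (Ideal.span (Set.range Q)).minimalPrimes | ¬ (M : Set A) ⊆ 𝔭}.Finite :=
      (Ideal.finite_minimalPrimes_of_isNoetherianRing A _).subset fun _ h => h.1
    obtain ⟨q, hq⟩ : ∃ q : M, ∀ 𝔭 ∈ (Ideal.span (Set.range Q)).minimalPrimes,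
        ¬ (M : Set A) ⊆ 𝔭 → (q : A) ∉ 𝔭 := by
      classical
      let s : Finset (Subspace K M) :=
        hfin.toFinset.image fun 𝔭 => (𝔭.restrictScalars K).comap M.subtype
      have hs : ⊤ ∉ s := by
        intro h
        obtain ⟨𝔭, h𝔭, h1⟩ := Finset.mem_image.mp h
        refine (hfin.mem_toFinset.mp h𝔭).2 fun a ha => ?_
        have h2 : (⟨a, ha⟩ : M) ∈ (𝔭.restrictScalars K).comap M.subtype := by
          rw [h1]; trivial
        exact h2
      obtain ⟨q, hq⟩ := (Set.ne_univ_iff_exists_notMem _).mp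
        (Subspace.biUnion_ne_univ_of_top_notMem hs)
      refine ⟨q, fun 𝔭 h1 h2 h3 => hq ?_⟩
      exact Set.mem_biUnion
        (Finset.mem_image_of_mem _ (hfin.mem_toFinset.mpr ⟨h1, h2⟩)) h3
    refine ⟨Fin.cons (q : A) Q, Fin.cases q.2 hQM, fun 𝔭 h𝔭 => ?_⟩
    rw [Fin.range_cons] at h𝔭
    have := h𝔭.1.1
    have hle : Ideal.span (Set.range Q) ≤ 𝔭 :=
      (Ideal.span_mono (Set.subset_insert _ _)).trans h𝔭.1.2
    obtain ⟨𝔮, h𝔮, h𝔮𝔭⟩ := Ideal.exists_minimalPrimes_le hle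
    by_cases hM : (M : Set A) ⊆ 𝔮
    · exact Or.inl (hM.trans h𝔮𝔭)
    · right
      have := h𝔮.1.1
      have hlt : 𝔮 < 𝔭 := lt_of_le_of_ne h𝔮𝔭 fun h =>
        hq 𝔮 h𝔮 hM (h ▸ h𝔭.1.2 (Ideal.subset_span (Set.mem_insert _ _)))
      push_cast
      exact (add_le_add_left ((hQ 𝔮 h𝔮).resolve_left hM) 1).trans
        (Ideal.height_add_one_le_of_lt_of_isPrime hlt)

theorem exists_isolating {K : Type*} [Field K] [IsAlgClosed K] {n D : ℕ}
    {S : Set (MvPolynomial (Fin n) K)} (hfin : {v : Fin n → K | ∀ P ∈ S, MvPolynomial.eval v P = 0}.Finite)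
    (hD : ∀ P ∈ S, P.totalDegree ≤ D) :
    ∃ Q : Fin n → MvPolynomial (Fin n) K, (∀ i, (Q i).totalDegree ≤ D) ∧
      ∀ v : Fin n → K, (∀ P ∈ S, MvPolynomial.eval v P = 0) → (∀ i, MvPolynomial.eval v (Q i) = 0) ∧
        ∀ 𝔭 : Ideal (MvPolynomial (Fin n) K), 𝔭.IsPrime → (∀ i, Q i ∈ 𝔭) →
          𝔭 ≤ RingHom.ker (MvPolynomial.eval v) → 𝔭 = RingHom.ker (MvPolynomial.eval v) := by
  have : Infinite K := IsAlgClosed.instInfinite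
  obtain ⟨Q, hQM, hQ⟩ := exists_forall_minimalPrimes_le_height (Submodule.span K S) n
  refine ⟨Q, fun i => ?_, fun v hv => ⟨fun i => ?_, fun 𝔭 h𝔭 hQ𝔭 hle => ?_⟩⟩
  · have h1 : Submodule.span K S ≤ restrictTotalDegree (Fin n) K D :=
      Submodule.span_le.mpr fun P hP => (mem_restrictTotalDegree _ _ _).mpr (hD P hP)
    exact (mem_restrictTotalDegree _ _ _).mp (h1 (hQM i))
  · have h1 : Submodule.span K S ≤ (RingHom.ker (MvPolynomial.eval v)).restrictScalars K :=
      Submodule.span_le.mpr fun P hP => hv P hP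
    exact h1 (hQM i)
  · have hspan : Ideal.span (Set.range Q) ≤ 𝔭 :=
      Ideal.span_le.mpr (Set.range_subset_iff.mpr hQ𝔭)
    obtain ⟨𝔮, h𝔮, h𝔮𝔭⟩ := Ideal.exists_minimalPrimes_le hspan
    have := h𝔮.1.1
    have hker : (RingHom.ker (MvPolynomial.eval v)).IsPrime := RingHom.ker_isPrime _
    suffices 𝔮 = RingHom.ker (MvPolynomial.eval v) from le_antisymm hle (this ▸ h𝔮𝔭)
    rcases hQ 𝔮 h𝔮 with h | h
    · exact eq_ker_eval_of_isPrime_of_finite hfin h𝔮.1.1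
        (Submodule.subset_span.trans h) (h𝔮𝔭.trans hle)
    · by_contra hne
      have h1 := Ideal.height_add_one_le_of_lt_of_isPrime (lt_of_le_of_ne (h𝔮𝔭.trans hle) hne)
      have h2 : ((RingHom.ker (MvPolynomial.eval v)).height : WithBot ℕ∞) ≤
          ringKrullDim (MvPolynomial (Fin n) K) := Ideal.height_le_ringKrullDim_of_isPrime
      rw [MvPolynomial.ringKrullDim_of_isNoetherianRing, ringKrullDim_eq_zero_of_field, zero_add,
        Nat.card_fin] at h2
      have h3 : (RingHom.ker (MvPolynomial.eval v)).height ≤ (n : ℕ∞) := by exact_mod_cast h2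
      have h4 : ((n + 1 : ℕ) : ℕ∞) ≤ n := by
        push_cast
        exact ((add_le_add_left h 1).trans h1).trans h3
      have h5 : n + 1 ≤ n := by exact_mod_cast h4
      omega

theorem totalDegree_map_le {σ R S : Type*} [CommSemiring R] [CommSemiring S] (φ : R →+* S)
    (P : MvPolynomial σ R) : (MvPolynomial.map φ P).totalDegree ≤ P.totalDegree :=
  Finset.sup_mono (support_map_subset φ P)

/-- The one-parameter deformation `Q i + T * x_i ^ (D + 1)` of a system `Q`. -/
def perturb {K : Type*} [Field K] {n : ℕ} (D : ℕ) (Q : Fin n → MvPolynomial (Fin n) K)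
    (i : Fin n) : MvPolynomial (Fin n) (Polynomial K) :=
  MvPolynomial.map Polynomial.C (Q i) + C Polynomial.X * X i ^ (D + 1)

/-- Evaluation of the deformation ring at the point `v` of the special fibre. -/
def specialEval {K : Type*} [Field K] {n : ℕ} (v : Fin n → K) :
    MvPolynomial (Fin n) (Polynomial K) →+* K :=
  eval₂Hom (Polynomial.evalRingHom 0) v

theorem specialEval_map_C {K : Type*} [Field K] {n : ℕ} (v : Fin n → K)
    (P : MvPolynomial (Fin n) K) :
    specialEval v (MvPolynomial.map Polynomial.C P) = MvPolynomial.eval v P := by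
  have h : (specialEval v).comp (MvPolynomial.map Polynomial.C) = MvPolynomial.eval v := by
    ext <;> simp [specialEval]
  rw [← h]; rfl

theorem specialEval_C {K : Type*} [Field K] {n : ℕ} (v : Fin n → K) (r : Polynomial K) :
    specialEval v (C r) = r.eval 0 := by
  simp [specialEval]

theorem exists_eq_map_C_add {K : Type*} [Field K] {n : ℕ}
    (b : MvPolynomial (Fin n) (Polynomial K)) :
    ∃ P c, b = MvPolynomial.map Polynomial.C P + C Polynomial.X * c := by
  induction b using MvPolynomial.induction_on with
  | C r =>
    refine ⟨C (r.coeff 0), C r.divX, ?_⟩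
    rw [map_C, ← C_mul, ← C_add, add_comm, Polynomial.X_mul_divX_add]
  | add b b' hb hb' =>
    obtain ⟨P, c, rfl⟩ := hb
    obtain ⟨P', c', rfl⟩ := hb'
    exact ⟨P + P', c + c', by rw [map_add]; ring⟩
  | mul_X b i hb =>
    obtain ⟨P, c, rfl⟩ := hb
    exact ⟨P * X i, c * X i, by rw [map_mul, map_X]; ring⟩

theorem lt_height_ker_specialEval {K : Type*} [Field K] {n : ℕ} (v : Fin n → K) :
    (n : ℕ∞) + 1 ≤ (RingHom.ker (specialEval v)).height := by
  let ψ := MvPolynomial.eval fun i => Polynomial.C (v i)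
  have hψ : (Polynomial.evalRingHom 0).comp ψ = specialEval v := by
    ext <;> simp [ψ, specialEval]
  have h1 : (RingHom.ker ψ).IsPrime := RingHom.ker_isPrime _
  have h2 : (RingHom.ker (specialEval v)).IsPrime := RingHom.ker_isPrime _
  refine (add_le_add_left (le_height_ker_eval fun i => Polynomial.C (v i)) 1).trans
    (Ideal.height_add_one_le_of_lt_of_isPrime (lt_of_le_of_ne (fun a ha => ?_) fun h => ?_))
  · rw [RingHom.mem_ker, ← hψ, RingHom.comp_apply, (RingHom.mem_ker).mp ha, map_zero]
  · have h3 : C Polynomial.X ∈ RingHom.ker (specialEval v) := by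
      simp [RingHom.mem_ker, specialEval_C]
    rw [← h, RingHom.mem_ker] at h3
    simp at h3

theorem exists_horizontal_prime {K : Type*} [Field K] {n : ℕ} (D : ℕ)
    {Q : Fin n → MvPolynomial (Fin n) K} {v : Fin n → K}
    (hv : ∀ i, MvPolynomial.eval v (Q i) = 0)
    (hiso : ∀ 𝔭 : Ideal (MvPolynomial (Fin n) K), 𝔭.IsPrime → (∀ i, Q i ∈ 𝔭) →
      𝔭 ≤ RingHom.ker (MvPolynomial.eval v) → 𝔭 = RingHom.ker (MvPolynomial.eval v)) :
    ∃ 𝔓 : Ideal (MvPolynomial (Fin n) (Polynomial K)), 𝔓.IsPrime ∧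
      (∀ i, perturb D Q i ∈ 𝔓) ∧ C Polynomial.X ∉ 𝔓 ∧ 𝔓 ≤ RingHom.ker (specialEval v) := by
  have hprime : (RingHom.ker (specialEval v)).IsPrime := RingHom.ker_isPrime _
  have hle : Ideal.span (Set.range (perturb D Q)) ≤ RingHom.ker (specialEval v) := by
    rw [Ideal.span_le, Set.range_subset_iff]
    intro i
    rw [SetLike.mem_coe, RingHom.mem_ker, perturb, map_add, map_mul, specialEval_map_C, hv,
      specialEval_C]
    simp
  obtain ⟨𝔓, h𝔓, h𝔓le⟩ := Ideal.exists_minimalPrimes_le hle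
  have := h𝔓.1.1
  have hmem : ∀ i, perturb D Q i ∈ 𝔓 := fun i => h𝔓.1.2 (Ideal.subset_span ⟨i, rfl⟩)
  refine ⟨𝔓, h𝔓.1.1, hmem, fun hX => ?_, h𝔓le⟩
  have hcomap : 𝔓.comap (MvPolynomial.map Polynomial.C) = RingHom.ker (MvPolynomial.eval v) := by
    refine hiso _ inferInstance (fun i => ?_) fun a ha => ?_
    · rw [Ideal.mem_comap]
      have h := 𝔓.sub_mem (hmem i) (𝔓.mul_mem_right (X i ^ (D + 1)) hX)
      rwa [perturb, add_sub_cancel_right] at h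
    · have h := h𝔓le (Ideal.mem_comap.mp ha)
      rwa [RingHom.mem_ker, specialEval_map_C] at h
  have hker : RingHom.ker (specialEval v) ≤ 𝔓 := by
    intro b hb
    obtain ⟨P, c, rfl⟩ := exists_eq_map_C_add b
    rw [RingHom.mem_ker, map_add, map_mul, specialEval_map_C, specialEval_C, Polynomial.eval_X,
      zero_mul, add_zero] at hb
    refine 𝔓.add_mem ?_ (𝔓.mul_mem_right c hX)
    rw [← Ideal.mem_comap, hcomap]
    exact hb
  have h1 := (lt_height_ker_specialEval v).trans (Ideal.height_mono hker)
  have h2 := Ideal.height_le_card_of_mem_minimalPrimes_span (Set.finite_range _) h𝔓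
  have h3 : (Set.range (perturb D Q)).ncard ≤ n := by
    rw [← Set.image_univ]
    refine (Set.ncard_image_le Set.finite_univ).trans ?_
    simp [Set.ncard_univ]
  have h4 : ((n + 1 : ℕ) : ℕ∞) ≤ n := by
    push_cast
    exact h1.trans (h2.trans (by exact_mod_cast h3))
  have h5 : n + 1 ≤ n := by exact_mod_cast h4
  omega

/-- Monomials all of whose exponents are at most `D`. -/
def boxMonomials (R : Type*) [CommRing R] (n D : ℕ) : Set (MvPolynomial (Fin n) R) :=
  Set.range fun m : Fin n → Fin (D + 1) =>
    monomial (Finsupp.equivFunOnFinite.symm fun i => (m i : ℕ)) 1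

theorem exists_pow_smul_mem {K : Type*} [Field K] {n D : ℕ} {Q : Fin n → MvPolynomial (Fin n) K}
    (hQ : ∀ i, (Q i).totalDegree ≤ D) (b : MvPolynomial (Fin n) (Polynomial K)) :
    ∃ k : ℕ, (Polynomial.X ^ k : Polynomial K) • b ∈
      (Ideal.span (Set.range (perturb D Q))).restrictScalars (Polynomial K) ⊔
        Submodule.span (Polynomial K) (boxMonomials (Polynomial K) n D) := by
  set I : Submodule (Polynomial K) (MvPolynomial (Fin n) (Polynomial K)) :=
    (Ideal.span (Set.range (perturb D Q))).restrictScalars (Polynomial K) with hI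
  set N := I ⊔ Submodule.span (Polynomial K) (boxMonomials (Polynomial K) n D) with hN
  let T : Submodule (Polynomial K) (MvPolynomial (Fin n) (Polynomial K)) :=
    { carrier := {b | ∃ k : ℕ, (Polynomial.X ^ k : Polynomial K) • b ∈ N}
      zero_mem' := ⟨0, by simp⟩
      add_mem' := by
        rintro b c ⟨k, hk⟩ ⟨l, hl⟩
        refine ⟨k + l, ?_⟩
        rw [smul_add]
        refine N.add_mem ?_ ?_
        · rw [pow_add, mul_comm, mul_smul]; exact N.smul_mem _ hk
        · rw [pow_add, mul_smul]; exact N.smul_mem _ hl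
      smul_mem' := by
        rintro r b ⟨k, hk⟩
        exact ⟨k, by rw [smul_comm]; exact N.smul_mem _ hk⟩ }
  have hNT : N ≤ T := fun b hb => ⟨0, by simpa using hb⟩
  have hmon : ∀ e : ℕ, ∀ m : Fin n →₀ ℕ, m.degree = e → monomial m (1 : Polynomial K) ∈ T := by
    intro e
    induction e using Nat.strong_induction_on with
    | _ e ih =>
    intro m hm
    have hlow : ∀ P : MvPolynomial (Fin n) (Polynomial K), P.totalDegree < e → P ∈ T := by
      intro P hP
      rw [P.as_sum]
      refine T.sum_mem fun m' hm' => ?_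
      have h1 : monomial m' (coeff m' P) = coeff m' P • monomial m' (1 : Polynomial K) := by
        rw [smul_monomial, smul_eq_mul, mul_one]
      rw [h1]
      refine T.smul_mem _ (ih m'.degree ?_ m' rfl)
      exact lt_of_le_of_lt (le_totalDegree hm') hP
    by_cases hbox : ∀ i, m i ≤ D
    · refine hNT (Submodule.mem_sup_right (Submodule.subset_span
        ⟨fun i => ⟨m i, Nat.lt_succ_of_le (hbox i)⟩, ?_⟩))
      show monomial (Finsupp.equivFunOnFinite.symm m) 1 = _
      rw [Finsupp.equivFunOnFinite_symm_coe]
    · push Not at hbox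
      obtain ⟨i, hi⟩ := hbox
      have hle : Finsupp.single i (D + 1) ≤ m := by
        rw [Finsupp.single_le_iff]; exact hi
      obtain ⟨m', rfl⟩ := exists_add_of_le hle
      have hkey : (Polynomial.X : Polynomial K) •
            monomial (Finsupp.single i (D + 1) + m') (1 : Polynomial K) =
          monomial m' 1 * perturb D Q i - monomial m' 1 * MvPolynomial.map Polynomial.C (Q i) := by
        rw [perturb, mul_add, add_sub_cancel_left, X_pow_eq_monomial, C_mul_monomial,
          monomial_mul, smul_monomial, add_comm]
        simp
      have hT : (Polynomial.X : Polynomial K) •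
            monomial (Finsupp.single i (D + 1) + m') (1 : Polynomial K) ∈ T := by
        rw [hkey]
        refine T.sub_mem (hNT (Submodule.mem_sup_left ?_)) (hlow _ ?_)
        · exact Ideal.mul_mem_left _ _ (Ideal.subset_span ⟨i, rfl⟩)
        · refine lt_of_le_of_lt (totalDegree_mul _ _) ?_
          have h1 : (monomial m' (1 : Polynomial K)).totalDegree ≤ m'.degree := by
            rw [totalDegree_monomial _ one_ne_zero]; rfl
          have h2 : (MvPolynomial.map Polynomial.C (Q i)).totalDegree ≤ D :=
            (totalDegree_map_le _ _).trans (hQ i)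
          rw [map_add, Finsupp.degree_single] at hm
          omega
      obtain ⟨k, hk⟩ := hT
      exact ⟨k + 1, by rw [pow_succ, mul_smul]; exact hk⟩
  have hb : b ∈ T := by
    rw [b.as_sum]
    refine T.sum_mem fun m _ => ?_
    have h1 : monomial m (coeff m b) = coeff m b • monomial m (1 : Polynomial K) := by
      rw [smul_monomial, smul_eq_mul, mul_one]
    rw [h1]
    exact T.smul_mem _ (hmon _ m rfl)
  exact hb

theorem exists_separating {K : Type*} [Field K] {n : ℕ} (V : Finset (Fin n → K)) (w : Fin n → K) :
    ∃ P : MvPolynomial (Fin n) K, MvPolynomial.eval w P ≠ 0 ∧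
      ∀ v ∈ V, v ≠ w → MvPolynomial.eval v P = 0 := by
  classical
  have hex : ∀ v : Fin n → K, ∃ P : MvPolynomial (Fin n) K,
      v ≠ w → MvPolynomial.eval w P ≠ 0 ∧ MvPolynomial.eval v P = 0 := by
    intro v
    by_cases h : v = w
    · exact ⟨0, fun h' => absurd h h'⟩
    · obtain ⟨i, hi⟩ := Function.ne_iff.mp h
      exact ⟨X i - C (v i), fun _ => ⟨by simpa [sub_eq_zero] using Ne.symm hi, by simp⟩⟩
  choose P hP using hex
  refine ⟨∏ v ∈ V.erase w, P v, ?_, fun v hv hvw => ?_⟩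
  · rw [map_prod]
    exact Finset.prod_ne_zero_iff.mpr fun v hv => (hP v (Finset.ne_of_mem_erase hv)).1
  · rw [map_prod]
    exact Finset.prod_eq_zero (Finset.mem_erase.mpr ⟨hvw, hv⟩) (hP v hvw).2

theorem card_le_of_isolated {K : Type*} [Field K] {n D : ℕ}
    {Q : Fin n → MvPolynomial (Fin n) K} (hQ : ∀ i, (Q i).totalDegree ≤ D)
    (V : Finset (Fin n → K))
    (hV : ∀ v ∈ V, (∀ i, MvPolynomial.eval v (Q i) = 0) ∧
      ∀ 𝔭 : Ideal (MvPolynomial (Fin n) K), 𝔭.IsPrime → (∀ i, Q i ∈ 𝔭) →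
        𝔭 ≤ RingHom.ker (MvPolynomial.eval v) → 𝔭 = RingHom.ker (MvPolynomial.eval v)) :
    V.card ≤ (D + 1) ^ n := by
  classical
  have h𝔓 := fun v : V => exists_horizontal_prime D (hV v v.2).1 (hV v v.2).2
  choose 𝔓 hprime hmem hX hle using h𝔓
  choose P hPne hPzero using fun w : V => exists_separating V (w : Fin n → K)
  let b : V → MvPolynomial (Fin n) (Polynomial K) := fun w => MvPolynomial.map Polynomial.C (P w)
  have hdvd : ∀ (m : ℕ) (c : V → Polynomial K), (∀ v, ∑ w, c w • b w ∈ 𝔓 v) →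
      ∀ w, Polynomial.X ^ m ∣ c w := by
    intro m
    induction m with
    | zero => intro c _ w; simp
    | succ m ih =>
      intro c hc
      have h0 : ∀ w, Polynomial.X ∣ c w := by
        intro v
        have h1 := hle v (hc v)
        rw [RingHom.mem_ker, map_sum, Finset.sum_eq_single v] at h1
        · rw [smul_eq_C_mul, map_mul, specialEval_C, specialEval_map_C] at h1
          rw [Polynomial.X_dvd_iff, Polynomial.coeff_zero_eq_eval_zero]
          exact (mul_eq_zero.mp h1).resolve_right (hPne v)
        · intro w _ hwv
          rw [smul_eq_C_mul, map_mul, specialEval_map_C,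
            hPzero w v v.2 fun h => hwv (Subtype.ext h.symm), mul_zero]
        · simp
      choose c' hc' using h0
      intro w
      rw [hc' w, pow_succ']
      refine mul_dvd_mul_left _ (ih c' (fun v => ?_) w)
      have h1 := hc v
      have h2 : ∑ w, c w • b w = C Polynomial.X * ∑ w, c' w • b w := by
        rw [Finset.mul_sum]
        refine Finset.sum_congr rfl fun w _ => ?_
        rw [hc' w, mul_smul, smul_eq_C_mul (_ • _)]
      rw [h2] at h1
      exact ((hprime v).mem_or_mem h1).resolve_left (hX v)
  choose k hk using fun w : V => exists_pow_smul_mem hQ (b w)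
  set I := Ideal.span (Set.range (perturb D Q)) with hI
  let π : MvPolynomial (Fin n) (Polynomial K) →ₗ[Polynomial K]
      MvPolynomial (Fin n) (Polynomial K) ⧸ I := (Ideal.Quotient.mkₐ (Polynomial K) I).toLinearMap
  have hπ : ∀ a, π a = 0 ↔ a ∈ I := fun a => Ideal.Quotient.eq_zero_iff_mem
  let y : V → MvPolynomial (Fin n) (Polynomial K) ⧸ I :=
    fun w => π ((Polynomial.X ^ k w : Polynomial K) • b w)
  have hy : LinearIndependent (Polynomial K) y := by
    rw [Fintype.linearIndependent_iff]
    intro c hc w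
    have h1 : ∑ w, (c w * Polynomial.X ^ k w) • b w ∈ I := by
      rw [← hπ, ← hc, map_sum]
      refine Finset.sum_congr rfl fun w _ => ?_
      rw [mul_smul, map_smul]
    have h2 : ∀ v, ∑ w, (c w * Polynomial.X ^ k w) • b w ∈ 𝔓 v := fun v =>
      (Ideal.span_le.mpr (Set.range_subset_iff.mpr (hmem v)) : I ≤ 𝔓 v) h1
    have h3 : c w * Polynomial.X ^ k w = 0 := by
      refine Polynomial.eq_zero_of_dvd_of_natDegree_lt
        (hdvd ((c w * Polynomial.X ^ k w).natDegree + 1) _ h2 w) ?_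
      rw [Polynomial.natDegree_X_pow]
      exact Nat.lt_succ_self _
    exact (mul_eq_zero.mp h3).resolve_right (pow_ne_zero _ Polynomial.X_ne_zero)
  have hfin : (π '' boxMonomials (Polynomial K) n D).Finite := (Set.finite_range _).image _
  have := hfin.fintype
  have hspan : Set.range y ≤ Submodule.span (Polynomial K) (π '' boxMonomials (Polynomial K) n D) := by
    rintro _ ⟨w, rfl⟩
    obtain ⟨a, ha, s, hs, has⟩ := Submodule.mem_sup.mp (hk w)
    have h1 : y w = π s := by
      simp only [y]
      rw [← has, map_add, (hπ a).mpr ha, zero_add]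
    rw [h1, Submodule.span_image]
    exact Submodule.mem_map_of_mem hs
  have h1 := linearIndependent_le_span_aux' y hy _ hspan
  rw [Fintype.card_coe] at h1
  refine h1.trans ?_
  rw [← Nat.card_eq_fintype_card, Nat.card_coe_set_eq]
  refine (Set.ncard_image_le (Set.finite_range _)).trans ?_
  rw [← Set.image_univ]
  refine (Set.ncard_image_le Set.finite_univ).trans ?_
  simp [Set.ncard_univ]

theorem ncard_le_of_finite {K : Type*} [Field K] [IsAlgClosed K] {n D : ℕ}
    {S : Set (MvPolynomial (Fin n) K)}
    (hfin : {v : Fin n → K | ∀ P ∈ S, MvPolynomial.eval v P = 0}.Finite)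
    (hD : ∀ P ∈ S, P.totalDegree ≤ D) :
    {v : Fin n → K | ∀ P ∈ S, MvPolynomial.eval v P = 0}.ncard ≤ (D + 1) ^ n := by
  obtain ⟨Q, hQ, hiso⟩ := exists_isolating hfin hD
  rw [Set.ncard_eq_toFinset_card _ hfin]
  exact card_le_of_isolated hQ _ fun v hv => hiso v (hfin.mem_toFinset.mp hv)

theorem min_le_finrank_map_aeval {F K : Type*} [Field F] [Field K] [Algebra F K] {n : ℕ}
    (v : Fin n → K) (d : ℕ) :
    min (d + 1) (Module.finrank F (Algebra.adjoin F (Set.range v))) ≤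
      Module.finrank F ((restrictTotalDegree (Fin n) F d).map (aeval v).toLinearMap) := by
  let L : ℕ → Submodule F K := fun j =>
    (restrictTotalDegree (Fin n) F j).map (aeval v).toLinearMap
  have hone : ∀ j, (1 : K) ∈ L j := fun j =>
    ⟨1, (mem_restrictTotalDegree _ _ _).mpr (by simp), by simp⟩
  have hmono : ∀ j, L j ≤ L (j + 1) := fun j => Submodule.map_mono fun P hP =>
    (mem_restrictTotalDegree _ _ _).mpr
      (((mem_restrictTotalDegree _ _ _).mp hP).trans (Nat.le_succ j))
  have hstab : ∀ j, L j = L (j + 1) →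
      L j = (Algebra.adjoin F (Set.range v)).toSubmodule := by
    intro j hj
    have hX : ∀ P : MvPolynomial (Fin n) F, aeval v P ∈ L j := by
      intro P
      induction P using MvPolynomial.induction_on with
      | C r =>
        rw [aeval_C, Algebra.algebraMap_eq_smul_one]
        exact (L j).smul_mem r (hone j)
      | add P P' hP hP' => rw [map_add]; exact (L j).add_mem hP hP'
      | mul_X P i hP =>
        obtain ⟨P', hP', h⟩ := hP
        rw [hj]
        refine ⟨P' * X i, (mem_restrictTotalDegree _ _ _).mpr ?_, ?_⟩
        · refine (totalDegree_mul _ _).trans ?_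
          rw [totalDegree_X]
          exact Nat.add_le_add_right ((mem_restrictTotalDegree _ _ _).mp hP') 1
        · rw [AlgHom.toLinearMap_apply] at h ⊢
          rw [map_mul, map_mul, h]
    refine le_antisymm ?_ ?_
    · rintro _ ⟨P, -, rfl⟩
      rw [Algebra.adjoin_range_eq_range_aeval]
      exact ⟨P, rfl⟩
    · rw [Algebra.adjoin_range_eq_range_aeval]
      rintro _ ⟨P, rfl⟩
      exact hX P
  change _ ≤ Module.finrank F (L d)
  induction d with
  | zero =>
    have h : L 0 ≠ ⊥ := fun h => one_ne_zero ((Submodule.mem_bot F).mp (h ▸ hone 0))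
    exact (min_le_left _ _).trans (Submodule.one_le_finrank_iff.mpr h)
  | succ d ih =>
    rcases (hmono d).eq_or_lt with h | h
    · rw [← h, hstab d h]
      exact min_le_right _ _
    · have h1 : Module.finrank F (L d) < Module.finrank F (L (d + 1)) :=
        Submodule.finrank_lt_finrank_of_lt h
      omega

theorem card_fiber_mul_le {F K : Type*} [Field F] [Finite F] [Field K] [Algebra F K] {n : ℕ}
    (p : ℕ) [Fact p.Prime] [CharP K p] (v : Fin n → K) (d : ℕ) (c : K) :
    Nat.card {h : restrictTotalDegree (Fin n) F d //
        c + aeval v (h : MvPolynomial (Fin n) F) ^ p = 0} *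
      Nat.card F ^ min (d + 1) (Module.finrank F (Algebra.adjoin F (Set.range v))) ≤
      Nat.card (restrictTotalDegree (Fin n) F d) := by
  have hfin : Finite (restrictTotalDegree (Fin n) F d) := Module.finite_of_finite F
  let φ : restrictTotalDegree (Fin n) F d →ₗ[F] K :=
    (aeval v).toLinearMap.domRestrict (restrictTotalDegree (Fin n) F d)
  have hrange : LinearMap.range φ =
      (restrictTotalDegree (Fin n) F d).map (aeval v).toLinearMap :=
    LinearMap.range_domRestrict _ _
  have hcard : Nat.card (restrictTotalDegree (Fin n) F d) =
      Nat.card (LinearMap.ker φ) * Nat.card F ^ Module.finrank F (LinearMap.range φ) := by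
    rw [← Module.natCard_eq_pow_finrank (K := F) (V := LinearMap.range φ),
      ← Nat.card_congr φ.quotKerEquivRange.toEquiv, mul_comm]
    exact AddSubgroup.card_eq_card_quotient_mul_card_addSubgroup (LinearMap.ker φ).toAddSubgroup
  have hfiber : Nat.card {h : restrictTotalDegree (Fin n) F d //
      c + aeval v (h : MvPolynomial (Fin n) F) ^ p = 0} ≤ Nat.card (LinearMap.ker φ) := by
    rcases isEmpty_or_nonempty {h : restrictTotalDegree (Fin n) F d //
      c + aeval v (h : MvPolynomial (Fin n) F) ^ p = 0} with _ | ⟨⟨h₀, hh₀⟩⟩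
    · simp
    · have key : ∀ h : {h : restrictTotalDegree (Fin n) F d //
          c + aeval v (h : MvPolynomial (Fin n) F) ^ p = 0}, h.1 - h₀ ∈ LinearMap.ker φ := by
        rintro ⟨h, hh⟩
        rw [LinearMap.mem_ker, map_sub, sub_eq_zero]
        apply frobenius_inj K p
        exact add_left_cancel (hh.trans hh₀.symm)
      refine Nat.card_le_card_of_injective (fun h => (⟨h.1 - h₀, key h⟩ : LinearMap.ker φ)) ?_
      intro h h' hhh
      exact Subtype.ext (sub_left_injective (congrArg Subtype.val hhh))
  rw [hcard, hrange]
  exact Nat.mul_le_mul hfiber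
    (Nat.pow_le_pow_right Nat.card_pos (min_le_finrank_map_aeval v d))

theorem exists_ncard_Wset_le {F : Type} [Field F] {p n ℓ τ : ℕ}
    {I : Ideal (Apoly F n)} {t : Fin ℓ → Apoly F n} (ht : ∀ r, (t r).totalDegree ≤ τ)
    {D : Fin ℓ → Derivation F (Apoly F n) (Apoly F n ⧸ I)}
    (hlift : ∃ C : ℕ, ∀ (i : Fin ℓ) (f : Apoly F n), ∃ b : Apoly F n,
      Ideal.Quotient.mk I b = D i f ∧ b.totalDegree ≤ f.totalDegree + C) :
    ∃ B : ℕ, ∀ d : ℕ, ∀ f₀ ∈ restrictTotalDegree (Fin n) F d, ∀ g : Fin ℓ → Apoly F n,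
      (∀ r, g r ∈ restrictTotalDegree (Fin n) F ((d - τ) / p)) →
      (Wset F n ℓ p I D t f₀ g ℓ).Finite →
      (Wset F n ℓ p I D t f₀ g ℓ).ncard ≤ (d + B) ^ n := by
  obtain ⟨C₀, hC⟩ := hlift
  obtain ⟨G, hG⟩ : I.FG := IsNoetherian.noetherian I
  refine ⟨τ + C₀ + G.sup totalDegree + 1, fun d f₀ hf₀ g hg hfin => ?_⟩
  set f : Apoly F n := f₀ + ∑ r, g r ^ p * t r with hf
  have hfdeg : f.totalDegree ≤ d + τ := by
    refine (totalDegree_add _ _).trans (max_le ?_ ?_)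
    · exact ((mem_restrictTotalDegree _ _ _).mp hf₀).trans (Nat.le_add_right _ _)
    · refine totalDegree_finsetSum_le fun r _ => (totalDegree_mul _ _).trans ?_
      have h1 : (g r ^ p).totalDegree ≤ d := by
        refine (totalDegree_pow _ _).trans ?_
        refine (Nat.mul_le_mul_left p ((mem_restrictTotalDegree _ _ _).mp (hg r))).trans ?_
        exact (Nat.mul_div_le _ _).trans (Nat.sub_le _ _)
      exact Nat.add_le_add h1 (ht r)
  choose b hbD hbdeg using fun i => hC i f
  let S : Set (MvPolynomial (Fin n) (AlgebraicClosure F)) :=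
    MvPolynomial.map (algebraMap F (AlgebraicClosure F)) '' (↑G ∪ Set.range b)
  have hW : Wset F n ℓ p I D t f₀ g ℓ = {v | ∀ P ∈ S, MvPolynomial.eval v P = 0} := by
    ext v
    have hev : ∀ P : Apoly F n,
        MvPolynomial.eval v (MvPolynomial.map (algebraMap F (AlgebraicClosure F)) P) =
          aeval v P := fun P => by rw [eval_map, aeval_def]
    simp only [S, Wset, Set.mem_ofPred_eq, Set.forall_mem_image, hev]
    constructor
    · rintro ⟨hv, hD⟩ P (hP | ⟨i, rfl⟩)
      · exact hv P (hG ▸ Ideal.subset_span hP)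
      · exact hD i i.2 (b i) (hbD i)
    · intro h
      have hv : ∀ P ∈ I, aeval v P = 0 := by
        have hle : I ≤ RingHom.ker (aeval v : Apoly F n →ₐ[F] AlgebraicClosure F) := by
          rw [← hG]
          exact Ideal.span_le.mpr fun P hP => h (Or.inl hP)
        exact fun P hP => hle hP
      refine ⟨hv, fun i _ c hc => ?_⟩
      have h1 := hv (c - b i) (Ideal.Quotient.eq.mp (hc.trans (hbD i).symm))
      rwa [map_sub, h (Or.inr ⟨i, rfl⟩), sub_zero] at h1
  rw [hW] at hfin ⊢
  refine (ncard_le_of_finite (D := d + τ + C₀ + G.sup totalDegree) hfin ?_).trans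
    (le_of_eq (by congr 1; ring))
  rintro _ ⟨P, hP | ⟨i, rfl⟩, rfl⟩
  · exact (totalDegree_map_le _ _).trans
      ((Finset.le_sup (f := totalDegree) hP).trans (Nat.le_add_left _ _))
  · refine (totalDegree_map_le _ _).trans ((hbdeg i).trans ?_)
    omega

theorem exists_forall_pow_le_mul_two_pow (n B k : ℕ) (hk : 0 < k) {ε : ℝ} (hε : 0 < ε) :
    ∃ N : ℕ, ∀ d ≥ N, ((d + B : ℕ) : ℝ) ^ n ≤ ε * 2 ^ (d / k + 1) := by
  have hlim := tendsto_pow_const_div_const_pow_of_one_lt n (r := (2 : ℝ)) one_lt_two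
  have hJ : Tendsto (fun d : ℕ => d / k + 1) atTop atTop :=
    (tendsto_add_atTop_nat 1).comp (Nat.tendsto_div_const_atTop hk.ne')
  have hpos : (0 : ℝ) < ε / ((k + B : ℕ) : ℝ) ^ n := by positivity
  obtain ⟨N, hN⟩ := eventually_atTop.mp
    ((hlim.comp hJ).eventually (gt_mem_nhds hpos))
  refine ⟨N, fun d hd => ?_⟩
  have h1 := hN d hd
  simp only [Function.comp_apply] at h1
  rw [div_lt_div_iff₀ (by positivity) (by positivity), ← mul_pow] at h1
  refine le_trans ?_ h1.le
  refine pow_le_pow_left₀ (by positivity) ?_ n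
  have h2 : d < k * (d / k + 1) := Nat.lt_mul_div_succ d hk
  have h3 : d + B ≤ (d / k + 1) * (k + B) := by nlinarith [Nat.zero_le (d / k * B)]
  exact_mod_cast h3


theorem one_sub_le_card_div_card {α β : Type*} [Finite α] [Nonempty α] {W : Set β}
    (hW : W.Finite) {M k : ℕ} (hM : W.ncard ≤ M) {big : β → Prop} {P : β → α → Prop}
    (hP : ∀ v ∈ W, big v → {h | P v h}.ncard * k ≤ Nat.card α) {ε : ℝ}
    (hk : 0 < k) (hMk : (M : ℝ) ≤ ε * k) :
    1 - ε ≤ (Nat.card {h : α // ¬ ∃ v ∈ W, big v ∧ P v h} : ℝ) / Nat.card α := by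
  classical
  let T : Finset β := hW.toFinset.filter big
  have hbad : {h : α | ∃ v ∈ W, big v ∧ P v h} = ⋃ v ∈ T, {h | P v h} := by
    ext h
    simp [T, and_assoc]
  have hle : {h : α | ∃ v ∈ W, big v ∧ P v h}.ncard * k ≤ M * Nat.card α := by
    rw [hbad]
    calc (⋃ v ∈ T, {h | P v h}).ncard * k
        ≤ (∑ v ∈ T, {h | P v h}.ncard) * k :=
          Nat.mul_le_mul_right _ (Finset.set_ncard_biUnion_le _ _)
      _ = ∑ v ∈ T, {h | P v h}.ncard * k := Finset.sum_mul _ _ _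
      _ ≤ ∑ _v ∈ T, Nat.card α := Finset.sum_le_sum fun v hv => by
          obtain ⟨hvW, hvb⟩ := Finset.mem_filter.mp hv
          exact hP v (hW.mem_toFinset.mp hvW) hvb
      _ = T.card * Nat.card α := by rw [Finset.sum_const, smul_eq_mul]
      _ ≤ M * Nat.card α := Nat.mul_le_mul_right _ <| (Finset.card_filter_le _ _).trans <| by
          rwa [← Set.ncard_eq_toFinset_card W hW]
  have hsum : {h : α | ∃ v ∈ W, big v ∧ P v h}.ncard +
      Nat.card {h : α // ¬ ∃ v ∈ W, big v ∧ P v h} = Nat.card α :=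
    Set.ncard_add_ncard_compl {h : α | ∃ v ∈ W, big v ∧ P v h}
  have hα : (0 : ℝ) < Nat.card α := Nat.cast_pos.mpr Nat.card_pos
  have hle' : ({h : α | ∃ v ∈ W, big v ∧ P v h}.ncard : ℝ) ≤ ε * Nat.card α := by
    have h1 : ({h : α | ∃ v ∈ W, big v ∧ P v h}.ncard : ℝ) * k ≤ M * Nat.card α := by
      exact_mod_cast hle
    refine le_of_mul_le_mul_right (h1.trans ?_) (Nat.cast_pos.mpr hk : (0 : ℝ) < k)
    calc (M : ℝ) * Nat.card α ≤ ε * k * Nat.card α := by gcongr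
      _ = ε * Nat.card α * k := by ring
  rw [le_div_iff₀ hα]
  have hsum' : ({h : α | ∃ v ∈ W, big v ∧ P v h}.ncard : ℝ) +
      Nat.card {h : α // ¬ ∃ v ∈ W, big v ∧ P v h} = Nat.card α := by exact_mod_cast hsum
  linarith

theorem statement12
    -- `q` a power of a prime `p`, `F` the field with `q` elements
    (p a q : ℕ) (hp : p.Prime) (ha : 0 < a) (hq : q = p ^ a)
    (F : Type) [Field F] [Fintype F] (hF : Fintype.card F = q)
    -- `U ⊆ 𝔸^n` of dimension `m`, `Q` of rank `ℓ ≥ m`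
    (n m ℓ : ℕ) (hml : m ≤ ℓ)
    (I : Ideal (Apoly F n))
    (hdim : ringKrullDim (Apoly F n ⧸ I) = (m : WithBot (WithTop ℕ)))
    -- the sections `t_i`, the unit `s`, and `τ = max_i deg t_i`
    (t : Fin ℓ → Apoly F n) (s : Apoly F n)
    (hs : ∀ v ∈ zeroLocusA F n I, aeval v s ≠ 0)
    (τ : ℕ) (hτ : τ = Finset.univ.sup fun i => (t i).totalDegree)
    -- the rescaled dual-basis derivations `D_i = s ∂_i`
    (D : Fin ℓ → Derivation F (Apoly F n) (Apoly F n ⧸ I))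
    (hDt : ∀ i j, D i (t j) = if i = j then Ideal.Quotient.mk I s else 0)
    -- minimal-degree lifts of `D_i f` have controlled degree
    (hlift : ∃ C : ℕ, ∀ (i : Fin ℓ) (f : Apoly F n), ∃ b : Apoly F n,
      Ideal.Quotient.mk I b = D i f ∧ b.totalDegree ≤ f.totalDegree + C) :
    -- conclusion: with `γ = ⌊(d − τ)/p⌋`, `η = ⌊d/p⌋`, conditioned on
    -- `f₀, g_1, …, g_ℓ` with `W_ℓ` finite, the probability over uniformly
    -- random `h ∈ A_{≤η}` that `H_f ∩ W_ℓ ∩ U_{> d/(ℓ+1)} = ∅` is `1 − o(1)`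
    ∀ ε : ℝ, 0 < ε → ∃ N : ℕ, ∀ d ≥ N,
      ∀ f₀ ∈ restrictTotalDegree (Fin n) F d,
      ∀ g : Fin ℓ → Apoly F n,
        (∀ r, g r ∈ restrictTotalDegree (Fin n) F ((d - τ) / p)) →
        (Wset F n ℓ p I D t f₀ g ℓ).Finite →
        1 - ε ≤
          (Nat.card {h : Ale F n (d / p) //
              ¬ ∃ v ∈ Wset F n ℓ p I D t f₀ g ℓ,
                d < (ℓ + 1) * degPt F n v ∧
                aeval v (f₀ + (∑ r, g r ^ p * t r) + (h : Apoly F n) ^ p)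
                  = 0} : ℝ)
            / (Nat.card (Ale F n (d / p)) : ℝ) := by
  intro ε hε
  have : Fact p.Prime := ⟨hp⟩
  have : CharP F p := charP_of_card_eq_prime_pow (hF.trans hq)
  have : CharP (AlgebraicClosure F) p :=
    charP_of_injective_algebraMap (algebraMap F (AlgebraicClosure F)).injective p
  have hcard : 2 ≤ Nat.card F := Finite.one_lt_card
  obtain ⟨B, hB⟩ := exists_ncard_Wset_le (p := p) (τ := τ) (I := I) (D := D)
    (fun r => hτ ▸ Finset.le_sup (f := fun i => (t i).totalDegree) (Finset.mem_univ r)) hlift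
  have hk : 0 < p * (ℓ + 1) := Nat.mul_pos hp.pos ℓ.succ_pos
  obtain ⟨N, hN⟩ := exists_forall_pow_le_mul_two_pow n B (p * (ℓ + 1)) hk hε
  refine ⟨N, fun d hd f₀ hf₀ g hg hfin => ?_⟩
  have hWcard := hB d f₀ hf₀ g hg hfin
  set W := Wset F n ℓ p I D t f₀ g ℓ
  set J := d / (p * (ℓ + 1)) + 1
  have : Finite (Ale F n (d / p)) := Module.finite_of_finite F
  have hfiber : ∀ v ∈ W, d < (ℓ + 1) * degPt F n v →
      {h : Ale F n (d / p) |
        aeval v (f₀ + (∑ r, g r ^ p * t r) + (h : Apoly F n) ^ p) = 0}.ncard * 2 ^ J ≤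
      Nat.card (Ale F n (d / p)) := by
    intro v _ hv
    refine le_trans ?_ (card_fiber_mul_le p v (d / p) (aeval v (f₀ + ∑ r, g r ^ p * t r)))
    refine Nat.mul_le_mul (le_of_eq ?_) ?_
    · simp only [map_add, map_pow]
      rfl
    · refine (Nat.pow_le_pow_left hcard J).trans (Nat.pow_le_pow_right (by omega) (le_min ?_ ?_))
      · exact Nat.succ_le_succ
          (Nat.div_le_div_left (Nat.le_mul_of_pos_right p ℓ.succ_pos) hp.pos)
      · refine Nat.succ_le_of_lt ((Nat.div_le_div_left (Nat.le_mul_of_pos_left _ hp.pos)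
          ℓ.succ_pos).trans_lt (Nat.div_lt_of_lt_mul hv))
  exact one_sub_le_card_div_card hfin hWcard hfiber (by positivity)
    (by exact_mod_cast hN d hd)

end
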